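/- arXiv:2402.13833 — 8 statements merged into one kernel-verified Lean document; each statement's English description precedes it below -/
import Mathlib

section
/- Let g1: G1 → G0 be an injective S-linear map between finitely generated Gorenstein projective S-modules such that ω·(Coker g1) = 0. Then there exists a unique S-linear map g0: G0 → G1 such that g1∘g0 = ω·id_{G0} and g0∘g1 = ω·id_{G1}; moreover g0 is injective and ω·(Coker g0) = 0, so that (g0: G0 → G1) is again an object of Mon(ω,𝒢). -/
open CategoryTheory LinearMap Function

/-- A module `M` over a commutative ring `A` is *Gorenstein projective* if the biduality
map `M → Hom_A(Hom_A(M,A),A)` is an isomorphism and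
`Ext^i_A(M,A) = 0 = Ext^i_A(Hom_A(M,A),A)` for all `i ≥ 1`. -/
noncomputable def IsGP (A : Type) [CommRing A] (M : Type) [AddCommGroup M] [Module A M] : Prop :=
  Function.Bijective (Module.Dual.eval A M) ∧
  (∀ i : ℕ, 0 < i →
    Subsingleton (((Ext A (ModuleCat A) i).obj
      (Opposite.op (ModuleCat.of A M))).obj (ModuleCat.of A A))) ∧
  (∀ i : ℕ, 0 < i →
    Subsingleton (((Ext A (ModuleCat A) i).obj
      (Opposite.op (ModuleCat.of A (Module.Dual A M)))).obj (ModuleCat.of A A)))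

/-- `f : G1 → G0` is an object of the monomorphism category `Mon(ω, 𝒢)`:
`G1`, `G0` are finitely generated Gorenstein projective `S`-modules, `f` is injective,
and `ω · Coker f = 0` (i.e. `ω • y ∈ range f` for all `y`). -/
def MonObj (S : Type) [CommRing S] (ω : S) {G1 G0 : Type}
    [AddCommGroup G1] [Module S G1] [AddCommGroup G0] [Module S G0]
    (f : G1 →ₗ[S] G0) : Prop :=
  Module.Finite S G1 ∧ Module.Finite S G0 ∧ IsGP S G1 ∧ IsGP S G0 ∧
  Function.Injective f ∧ ∀ y : G0, ω • y ∈ LinearMap.range f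

/-- for any object `g1 : G1 → G0` of `Mon(ω, 𝒢)`, there is a unique
`g0 : G0 → G1` with `g1 ∘ g0 = ω • id` and `g0 ∘ g1 = ω • id`; moreover any such `g0`
is again an object of `Mon(ω, 𝒢)`. -/
theorem stmt_0 (S : Type) [CommRing S] [IsNoetherianRing S] [IsLocalRing S]
    (ω : S) (hω : ω ∈ IsLocalRing.maximalIdeal S) (hreg : ω ∈ nonZeroDivisors S)
    (G1 G0 : Type) [AddCommGroup G1] [Module S G1] [AddCommGroup G0] [Module S G0]
    (g1 : G1 →ₗ[S] G0) (hg1 : MonObj S ω g1) :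
    (∃! g0 : G0 →ₗ[S] G1,
        g1 ∘ₗ g0 = ω • (LinearMap.id : G0 →ₗ[S] G0) ∧
        g0 ∘ₗ g1 = ω • (LinearMap.id : G1 →ₗ[S] G1)) ∧
    (∀ g0 : G0 →ₗ[S] G1,
        g1 ∘ₗ g0 = ω • (LinearMap.id : G0 →ₗ[S] G0) →
        g0 ∘ₗ g1 = ω • (LinearMap.id : G1 →ₗ[S] G1) →
        MonObj S ω g0) := by
  obtain ⟨hf1, hf0, hG1, hG0, hinj, hran⟩ := hg1
  refine ⟨?_, ?_⟩
  · choose f hf using hran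
    refine ⟨⟨⟨f, fun x y => hinj ?_⟩, fun c x => hinj ?_⟩, ⟨?_, ?_⟩, ?_⟩
    · rw [map_add, hf, hf, hf, smul_add]
    · simp only [RingHom.id_apply, map_smul]
      rw [hf, hf, smul_comm]
    · ext x
      exact hf x
    · ext x
      apply hinj
      simpa using hf (g1 x)
    · rintro g ⟨hg, -⟩
      ext x
      apply hinj
      exact (LinearMap.congr_fun hg x).trans (hf x).symm
  · intro g0 h1 h2
    refine ⟨hf0, hf1, hG0, hG1, ?_, fun y => ⟨g1 y, LinearMap.congr_fun h2 y⟩⟩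
    rw [injective_iff_map_eq_zero]
    intro x hx
    have hx2 : ω • x = 0 := by
      have := LinearMap.congr_fun h1 x
      simpa [hx] using this.symm
    apply hG0.1.1
    ext φ
    have h3 : ω * φ x = 0 := by
      rw [← smul_eq_mul, ← map_smul, hx2, map_zero]
    simpa using (mul_left_mem_nonZeroDivisors_eq_zero_iff hreg).1 h3
end

section
/- Consider S-modules M, X, L, N, Y, T and S-linear maps g: M → X, h: X → L, f: M → N, ψ: X → Y, g': N → Y, h': Y → L, θ: N → T, φ: Y → T forming a commutative diagram (i.e. ψ∘g = g'∘f, h'∘ψ = h, φ∘g' = θ) in which the rows 0 → M → X → L and 0 → N → Y → L → 0 are exact and the columns 0 → M → N → T → 0 and 0 → X → Y → T → 0 are exact. If M, X, L, N and T are all annihilated by ω, then Y is annihilated by ω (hence the middle row and the middle column consist of R-modules). -/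
open CategoryTheory LinearMap Function

/-- in a commutative diagram with exact rows `0 → M → X → L` and
`0 → N → Y → L → 0` and exact columns `0 → M → N → T → 0` and `0 → X → Y → T → 0`,
if `M, X, L, N, T` are annihilated by `ω` then so is `Y`. -/
theorem stmt_1 (S : Type) [CommRing S] [IsNoetherianRing S] [IsLocalRing S]
    (ω : S) (hω : ω ∈ IsLocalRing.maximalIdeal S) (hreg : ω ∈ nonZeroDivisors S)
    (M X L N Y T : Type)
    [AddCommGroup M] [Module S M] [AddCommGroup X] [Module S X]
    [AddCommGroup L] [Module S L] [AddCommGroup N] [Module S N]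
    [AddCommGroup Y] [Module S Y] [AddCommGroup T] [Module S T]
    [Module.Finite S M] [Module.Finite S X] [Module.Finite S L]
    [Module.Finite S N] [Module.Finite S Y] [Module.Finite S T]
    (g : M →ₗ[S] X) (h : X →ₗ[S] L) (f : M →ₗ[S] N) (ψ : X →ₗ[S] Y)
    (g' : N →ₗ[S] Y) (h' : Y →ₗ[S] L) (θ : N →ₗ[S] T) (φ : Y →ₗ[S] T)
    (hc1 : ψ ∘ₗ g = g' ∘ₗ f) (hc2 : h' ∘ₗ ψ = h) (hc3 : φ ∘ₗ g' = θ)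
    (hginj : Function.Injective g) (hgh : Function.Exact g h)
    (hg'inj : Function.Injective g') (hg'h' : Function.Exact g' h')
    (hh'surj : Function.Surjective h')
    (hfinj : Function.Injective f) (hfθ : Function.Exact f θ)
    (hθsurj : Function.Surjective θ)
    (hψinj : Function.Injective ψ) (hψφ : Function.Exact ψ φ)
    (hφsurj : Function.Surjective φ)
    (hM : ∀ m : M, ω • m = 0) (hX : ∀ x : X, ω • x = 0) (hL : ∀ l : L, ω • l = 0)
    (hN : ∀ n : N, ω • n = 0) (hT : ∀ t : T, ω • t = 0) :
    ∀ y : Y, ω • y = 0 := by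
  intro y
  obtain ⟨n, hn⟩ := hθsurj (φ y)
  have h0 : φ (y - g' n) = 0 := by
    rw [map_sub, ← hn, ← hc3, LinearMap.comp_apply, sub_self]
  obtain ⟨x, hx⟩ := (hψφ _).1 h0
  have hy : y = ψ x + g' n := by rw [hx, sub_add_cancel]
  rw [hy, smul_add, ← map_smul, ← map_smul, hX, hN, map_zero, map_zero, add_zero]
end

section
/- Let φ = (φ1,φ0): (g1: G1 → G0) → (f1: K1 → K0) and θ = (θ1,θ0): (f1: K1 → K0) → (h1: T1 → T0) be morphisms in Mon(ω,𝒢) such that φ1, φ0, θ1, θ0 are injective and the induced maps on componentwise cokernels, l1: Coker φ1 → Coker φ0 and e1: Coker θ1 → Coker θ0, are objects of Mon(ω,𝒢). Then the composite θ∘φ is componentwise injective and the induced map z1: Z1 → Z0 on its componentwise cokernels (Z_i = Coker(θ_i∘φ_i)) is an object of Mon(ω,𝒢): Z1 and Z0 are finitely generated Gorenstein projective, z1 is injective, and ω·(Coker z1) = 0. In other words, the composition of admissible monics in Mon(ω,𝒢) is an admissible monic. -/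
open CategoryTheory LinearMap Function

/-- The map induced on (componentwise) cokernels by a morphism
`(φ1, φ0) : (g : A → B) → (f : A' → B')` of the morphism category, i.e. the map
`Coker φ1 = A'/im φ1 → Coker φ0 = B'/im φ0` induced by `f`. -/
noncomputable def cokerMap {S : Type} [CommRing S] {A B A' B' : Type}
    [AddCommGroup A] [Module S A] [AddCommGroup B] [Module S B]
    [AddCommGroup A'] [Module S A'] [AddCommGroup B'] [Module S B']
    (g : A →ₗ[S] B) (f : A' →ₗ[S] B') (φ1 : A →ₗ[S] A') (φ0 : B →ₗ[S] B')
    (hcomm : f ∘ₗ φ1 = φ0 ∘ₗ g) :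
    (A' ⧸ LinearMap.range φ1) →ₗ[S] (B' ⧸ LinearMap.range φ0) :=
  Submodule.mapQ _ _ f (by
    rintro _ ⟨x, rfl⟩
    exact ⟨g x, (LinearMap.congr_fun hcomm x).symm⟩)

/-- Vanishing of `Ext`, in terms of cocycles of a projective resolution. -/
lemma subsingleton_Ext_iff_cocycle {A : Type} [CommRing A] {X : ModuleCat.{0} A}
    (P : ProjectiveResolution X) (Y : ModuleCat.{0} A) (n : ℕ) :
    Subsingleton (((Ext A (ModuleCat.{0} A) (n + 1)).obj (Opposite.op X)).obj Y) ↔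
      ∀ f : P.complex.X (n + 1) ⟶ Y, P.complex.d (n + 2) (n + 1) ≫ f = 0 →
        ∃ g : P.complex.X n ⟶ Y, P.complex.d (n + 1) n ≫ g = f := by
  rw [← ModuleCat.isZero_iff_subsingleton, (P.isoExt (R := A) (n + 1) Y).isZero_iff,
    ← HomologicalComplex.exactAt_iff_isZero_homology,
    HomologicalComplex.exactAt_iff' _ n (n + 1) (n + 2) (by simp) (by simp),
    ShortComplex.moduleCat_exact_iff]
  rfl

/-- The two versions of `Ext` in the library vanish simultaneously. -/
lemma subsingleton_Ext_iff {A : Type} [CommRing A] (X Y : ModuleCat.{0} A) (n : ℕ) :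
    Subsingleton (((Ext A (ModuleCat.{0} A) (n + 1)).obj (Opposite.op X)).obj Y) ↔
      Subsingleton (Abelian.Ext.{0} X Y (n + 1)) := by
  have P := projectiveResolution X
  rw [subsingleton_Ext_iff_cocycle P]
  constructor
  · intro h
    refine subsingleton_of_forall_eq 0 fun α => ?_
    obtain ⟨f, hf, rfl⟩ := P.extMk_surjective α (n + 2) rfl
    rw [P.extMk_eq_zero_iff f (n + 2) rfl hf n rfl]
    exact h f hf
  · intro h f hf
    rw [← P.extMk_eq_zero_iff f (n + 2) rfl hf n rfl]
    exact Subsingleton.elim _ _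

section GP

variable {A : Type} [CommRing A] {L M N : Type} [AddCommGroup L] [Module A L]
  [AddCommGroup M] [Module A M] [AddCommGroup N] [Module A N]

/-- All higher `Ext` groups into the base ring vanish. -/
def ExtVanish (A : Type) [CommRing A] (M : Type) [AddCommGroup M] [Module A M] : Prop :=
  ∀ n : ℕ, Subsingleton (Abelian.Ext.{0} (ModuleCat.of A M) (ModuleCat.of A A) (n + 1))

lemma extVanish_iff : ExtVanish A M ↔ ∀ i : ℕ, 0 < i →
    Subsingleton (((Ext A (ModuleCat A) i).obj
      (Opposite.op (ModuleCat.of A M))).obj (ModuleCat.of A A)) := by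
  constructor
  · rintro h (_ | i) hi
    · omega
    · exact (subsingleton_Ext_iff _ _ i).2 (h i)
  · intro h n
    exact (subsingleton_Ext_iff _ _ n).1 (h (n + 1) (Nat.succ_pos n))

/-- A short exact sequence of modules as a short exact complex. -/
lemma shortExact_mk (f : L →ₗ[A] M) (g : M →ₗ[A] N) (hf : Function.Injective f)
    (hfg : Function.Exact f g) (hg : Function.Surjective g) :
    (ShortComplex.mk (ModuleCat.ofHom f) (ModuleCat.ofHom g)
      (by ext x; exact hfg.apply_apply_eq_zero x)).ShortExact where
  exact := by
    rw [ShortComplex.moduleCat_exact_iff]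
    exact fun x hx => (hfg x).1 hx
  mono_f := (ModuleCat.mono_iff_injective _).2 hf
  epi_g := (ModuleCat.epi_iff_surjective _).2 hg

lemma ExtVanish.extension (f : L →ₗ[A] M) (g : M →ₗ[A] N) (hf : Function.Injective f)
    (hfg : Function.Exact f g) (hg : Function.Surjective g)
    (hL : ExtVanish A L) (hN : ExtVanish A N) : ExtVanish A M := by
  intro n
  have hS := shortExact_mk f g hf hfg hg
  refine subsingleton_of_forall_eq 0 fun x => ?_
  have := hL n
  have := hN n
  obtain ⟨y, hy⟩ := Abelian.Ext.contravariant_sequence_exact₂ hS _ x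
    (Subsingleton.elim (α := Abelian.Ext.{0} (ModuleCat.of A L) (ModuleCat.of A A) (n + 1)) _ _)
  rw [← hy, Subsingleton.elim (α := Abelian.Ext.{0} (ModuleCat.of A N) (ModuleCat.of A A) (n + 1))
    y 0, Abelian.Ext.comp_zero]

lemma ExtVanish.dualMap_surjective (f : L →ₗ[A] M) (g : M →ₗ[A] N) (hf : Function.Injective f)
    (hfg : Function.Exact f g) (hg : Function.Surjective g)
    (hN : ExtVanish A N) : Function.Surjective f.dualMap := by
  intro u
  have hS := shortExact_mk f g hf hfg hg
  have := hN 0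
  obtain ⟨y, hy⟩ := Abelian.Ext.contravariant_sequence_exact₁ hS (ModuleCat.of A A)
    (Abelian.Ext.mk₀ (ModuleCat.ofHom u)) (n₁ := 1) rfl
    (Subsingleton.elim (α := Abelian.Ext.{0} (ModuleCat.of A N) (ModuleCat.of A A) (0 + 1)) _ _)
  obtain ⟨v, rfl⟩ := (Abelian.Ext.mk₀_bijective _ _).2 y
  rw [Abelian.Ext.mk₀_comp_mk₀] at hy
  have h := (Abelian.Ext.mk₀_bijective _ _).1 hy
  refine ⟨v.hom, ?_⟩
  ext x
  exact congrArg (fun w => w.hom x) h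

lemma dualMap_exact (f : L →ₗ[A] M) (g : M →ₗ[A] N)
    (hfg : Function.Exact f g) (hg : Function.Surjective g) :
    Function.Exact g.dualMap f.dualMap := by
  intro u
  constructor
  · intro hu
    have hk : LinearMap.ker g ≤ LinearMap.ker u := by
      intro x hx
      obtain ⟨y, rfl⟩ := (hfg x).1 hx
      exact LinearMap.congr_fun hu y
    refine ⟨((LinearMap.ker g).liftQ u hk) ∘ₗ
      (g.quotKerEquivOfSurjective hg).symm.toLinearMap, ?_⟩
    ext x
    have : (g.quotKerEquivOfSurjective hg).symm (g x) = Submodule.Quotient.mk x := by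
      rw [LinearEquiv.symm_apply_eq]; rfl
    simp [this]
  · rintro ⟨v, rfl⟩
    ext x
    simp [hfg.apply_apply_eq_zero x]

lemma IsGP.extension (f : L →ₗ[A] M) (g : M →ₗ[A] N) (hf : Function.Injective f)
    (hfg : Function.Exact f g) (hg : Function.Surjective g)
    (hL : IsGP A L) (hN : IsGP A N) : IsGP A M := by
  obtain ⟨bL, eL, dL⟩ := hL
  obtain ⟨bN, eN, dN⟩ := hN
  rw [← extVanish_iff] at eL dL eN dN
  have hs : Function.Surjective f.dualMap :=
    ExtVanish.dualMap_surjective f g hf hfg hg eN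
  have hi : Function.Injective g.dualMap := LinearMap.dualMap_injective_of_surjective hg
  have he : Function.Exact g.dualMap f.dualMap := dualMap_exact f g hfg hg
  have hi2 : Function.Injective f.dualMap.dualMap := LinearMap.dualMap_injective_of_surjective hs
  have he2 : Function.Exact f.dualMap.dualMap g.dualMap.dualMap := dualMap_exact _ _ he hs
  have nf : ∀ x, Module.Dual.eval A M (f x) = f.dualMap.dualMap (Module.Dual.eval A L x) :=
    fun x => rfl
  have ng : ∀ x, Module.Dual.eval A N (g x) = g.dualMap.dualMap (Module.Dual.eval A M x) :=
    fun x => rfl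
  refine ⟨⟨?_, ?_⟩, ?_, ?_⟩
  · rw [injective_iff_map_eq_zero]
    intro x hx
    have h0 : g x = 0 := bN.1 (by rw [ng, hx, map_zero, map_zero])
    obtain ⟨y, rfl⟩ := (hfg x).1 h0
    have h1 : y = 0 := by
      apply bL.1
      apply hi2
      rw [← nf, hx, map_zero, map_zero]
    rw [h1, map_zero]
  · intro w
    obtain ⟨c, hc⟩ := bN.2 (g.dualMap.dualMap w)
    obtain ⟨x, rfl⟩ := hg c
    have h0 : g.dualMap.dualMap (w - Module.Dual.eval A M x) = 0 := by
      rw [map_sub, ← ng, hc, sub_self]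
    obtain ⟨v, hv⟩ := (he2 _).1 h0
    obtain ⟨y, rfl⟩ := bL.2 v
    refine ⟨x + f y, ?_⟩
    rw [map_add, nf, hv, add_sub_cancel]
  · rw [← extVanish_iff]
    exact ExtVanish.extension f g hf hfg hg eL eN
  · rw [← extVanish_iff]
    exact ExtVanish.extension g.dualMap f.dualMap hi he hs dN dL

/-- The cokernel of a composite of monics is Gorenstein projective if both cokernels are. -/
lemma IsGP.coker_comp (φ : L →ₗ[A] M) (θ : M →ₗ[A] N) (hθ : Function.Injective θ)
    (h1 : IsGP A (M ⧸ LinearMap.range φ)) (h2 : IsGP A (N ⧸ LinearMap.range θ)) :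
    IsGP A (N ⧸ LinearMap.range (θ ∘ₗ φ)) := by
  have hle : LinearMap.range φ ≤ (LinearMap.range (θ ∘ₗ φ)).comap θ := by
    rintro _ ⟨x, rfl⟩
    exact ⟨x, rfl⟩
  have hle2 : LinearMap.range (θ ∘ₗ φ) ≤ LinearMap.range θ := LinearMap.range_comp_le_range _ _
  refine IsGP.extension (Submodule.mapQ _ _ θ hle) (Submodule.factor hle2) ?_ ?_ ?_ h1 h2
  · rw [injective_iff_map_eq_zero]
    intro x hx
    obtain ⟨k, rfl⟩ := Submodule.Quotient.mk_surjective _ x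
    rw [Submodule.mapQ_apply, Submodule.Quotient.mk_eq_zero] at hx
    obtain ⟨y, hy⟩ := hx
    rw [Submodule.Quotient.mk_eq_zero]
    exact ⟨y, hθ hy⟩
  · intro x
    obtain ⟨t, rfl⟩ := Submodule.Quotient.mk_surjective _ x
    constructor
    · intro h
      have h' : (Submodule.Quotient.mk t : N ⧸ LinearMap.range θ) = 0 := h
      rw [Submodule.Quotient.mk_eq_zero] at h'
      obtain ⟨k, rfl⟩ := h'
      exact ⟨Submodule.Quotient.mk k, rfl⟩
    · rintro ⟨y, hy⟩
      obtain ⟨k, rfl⟩ := Submodule.Quotient.mk_surjective _ y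
      rw [← hy]
      exact (Submodule.Quotient.mk_eq_zero (LinearMap.range θ)).2 ⟨k, rfl⟩
  · exact Submodule.factor_surjective hle2

end GP

/-- the composition of two admissible monics in `Mon(ω, 𝒢)` is an
admissible monic. -/
theorem stmt_2 (S : Type) [CommRing S] [IsNoetherianRing S] [IsLocalRing S]
    (ω : S) (hω : ω ∈ IsLocalRing.maximalIdeal S) (hreg : ω ∈ nonZeroDivisors S)
    (G1 G0 K1 K0 T1 T0 : Type)
    [AddCommGroup G1] [Module S G1] [AddCommGroup G0] [Module S G0]
    [AddCommGroup K1] [Module S K1] [AddCommGroup K0] [Module S K0]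
    [AddCommGroup T1] [Module S T1] [AddCommGroup T0] [Module S T0]
    (g1 : G1 →ₗ[S] G0) (f1 : K1 →ₗ[S] K0) (h1 : T1 →ₗ[S] T0)
    (hG : MonObj S ω g1) (hK : MonObj S ω f1) (hT : MonObj S ω h1)
    (φ1 : G1 →ₗ[S] K1) (φ0 : G0 →ₗ[S] K0) (hφ : f1 ∘ₗ φ1 = φ0 ∘ₗ g1)
    (θ1 : K1 →ₗ[S] T1) (θ0 : K0 →ₗ[S] T0) (hθ : h1 ∘ₗ θ1 = θ0 ∘ₗ f1)
    (hφ1 : Function.Injective φ1) (hφ0 : Function.Injective φ0)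
    (hθ1 : Function.Injective θ1) (hθ0 : Function.Injective θ0)
    (hl1 : MonObj S ω (cokerMap g1 f1 φ1 φ0 hφ))
    (he1 : MonObj S ω (cokerMap f1 h1 θ1 θ0 hθ)) :
    Function.Injective (θ1 ∘ₗ φ1) ∧ Function.Injective (θ0 ∘ₗ φ0) ∧
    MonObj S ω (cokerMap g1 h1 (θ1 ∘ₗ φ1) (θ0 ∘ₗ φ0) (by
      ext x
      have a := LinearMap.congr_fun hθ (φ1 x)
      have b := LinearMap.congr_fun hφ x
      simp only [LinearMap.comp_apply] at a b ⊢
      rw [a, b])) := by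
  obtain ⟨-, -, gl1, gl0, il, -⟩ := hl1
  obtain ⟨-, -, ge1, ge0, ie, -⟩ := he1
  obtain ⟨fT1, fT0, -, -, -, wT⟩ := hT
  refine ⟨hθ1.comp hφ1, hθ0.comp hφ0, inferInstance, inferInstance,
    IsGP.coker_comp φ1 θ1 hθ1 gl1 ge1, IsGP.coker_comp φ0 θ0 hθ0 gl0 ge0, ?_, ?_⟩
  · rw [injective_iff_map_eq_zero] at il ie ⊢
    intro x hx
    obtain ⟨t, rfl⟩ := Submodule.Quotient.mk_surjective _ x
    obtain ⟨a, ha⟩ := (Submodule.Quotient.mk_eq_zero _).1 hx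
    have h1t : (Submodule.Quotient.mk t : T1 ⧸ LinearMap.range θ1) = 0 :=
      ie _ ((Submodule.Quotient.mk_eq_zero _).2 ⟨φ0 a, ha⟩)
    obtain ⟨k, rfl⟩ := (Submodule.Quotient.mk_eq_zero _).1 h1t
    have hk : φ0 a = f1 k := hθ0 (ha.trans (LinearMap.congr_fun hθ k))
    have h1k : (Submodule.Quotient.mk k : K1 ⧸ LinearMap.range φ1) = 0 :=
      il _ ((Submodule.Quotient.mk_eq_zero _).2 ⟨a, hk⟩)
    obtain ⟨b, rfl⟩ := (Submodule.Quotient.mk_eq_zero _).1 h1k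
    exact (Submodule.Quotient.mk_eq_zero _).2 ⟨b, rfl⟩
  · intro y
    obtain ⟨t, rfl⟩ := Submodule.Quotient.mk_surjective _ y
    obtain ⟨s, hs⟩ := wT t
    refine ⟨Submodule.Quotient.mk s, ?_⟩
    rw [← Submodule.Quotient.mk_smul, ← hs]
    rfl
end

section
/- Let φ = (φ1,φ0): (f: G1 → G0) → (g: K1 → K0) be an admissible monic in Mon(ω,𝒢), i.e. φ1 and φ0 are injective and the induced map l: Coker φ1 → Coker φ0 is an object of Mon(ω,𝒢), and let θ = (θ1,θ0): (f: G1 → G0) → (h: T1 → T0) be an arbitrary morphism in Mon(ω,𝒢). For i = 0,1 let E_i be the pushout of φ_i along θ_i, and let h': E1 → E0 be the induced map. Then (h': E1 → E0) is an object of Mon(ω,𝒢), the induced morphism (h: T1 → T0) → (h': E1 → E0) is componentwise injective, and its componentwise cokernel is isomorphic to (l: Coker φ1 → Coker φ0); in particular this morphism is an admissible monic, so pushouts of admissible monics along arbitrary morphisms exist in Mon(ω,𝒢) and are admissible monics. -/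
open CategoryTheory LinearMap Function

/-- The pushout of two linear maps `θ : A → T`, `φ : A → K`, realized as
`(T × K) / im (θ, -φ)`. -/
abbrev pushoutMod {S : Type} [CommRing S] {A T K : Type}
    [AddCommGroup A] [Module S A] [AddCommGroup T] [Module S T]
    [AddCommGroup K] [Module S K] (θ : A →ₗ[S] T) (φ : A →ₗ[S] K) : Type :=
  (T × K) ⧸ LinearMap.range (θ.prod (-φ))

/-- The canonical map `T → (T × K) / im (θ, -φ)` into the pushout. -/
noncomputable def pushoutInl {S : Type} [CommRing S] {A T K : Type}
    [AddCommGroup A] [Module S A] [AddCommGroup T] [Module S T]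
    [AddCommGroup K] [Module S K] (θ : A →ₗ[S] T) (φ : A →ₗ[S] K) :
    T →ₗ[S] pushoutMod θ φ :=
  (Submodule.mkQ _) ∘ₗ (LinearMap.inl S T K)

/-- The map induced between two pushouts by a compatible triple of maps. -/
noncomputable def pushoutMap {S : Type} [CommRing S] {A T K A' T' K' : Type}
    [AddCommGroup A] [Module S A] [AddCommGroup T] [Module S T]
    [AddCommGroup K] [Module S K] [AddCommGroup A'] [Module S A']
    [AddCommGroup T'] [Module S T'] [AddCommGroup K'] [Module S K']
    (θ : A →ₗ[S] T) (φ : A →ₗ[S] K) (θ' : A' →ₗ[S] T') (φ' : A' →ₗ[S] K')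
    (f : A →ₗ[S] A') (h : T →ₗ[S] T') (g : K →ₗ[S] K')
    (hθ : h ∘ₗ θ = θ' ∘ₗ f) (hφ : g ∘ₗ φ = φ' ∘ₗ f) :
    pushoutMod θ φ →ₗ[S] pushoutMod θ' φ' :=
  Submodule.mapQ _ _ (h.prodMap g) (by
    rintro _ ⟨a, rfl⟩
    refine ⟨f a, ?_⟩
    have e1 := LinearMap.congr_fun hθ a
    have e2 := LinearMap.congr_fun hφ a
    simp only [LinearMap.comp_apply] at e1 e2
    simp [LinearMap.prod_apply, Prod.ext_iff, ← e1, ← e2])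


/-- Vanishing of the derived-functor `Ext` is vanishing of the derived-category `Ext`. -/
theorem ext_subsingleton_iff (A : Type) [CommRing A] (M N : ModuleCat.{0} A) (n : ℕ) :
    Subsingleton (((Ext A (ModuleCat.{0} A) (n + 1)).obj (Opposite.op M)).obj N) ↔
      Subsingleton (Abelian.Ext.{0} M N (n + 1)) := by
  obtain ⟨⟨P⟩⟩ := HasProjectiveResolutions.out (C := ModuleCat.{0} A) M
  have h1 : Subsingleton (((Ext A (ModuleCat.{0} A) (n + 1)).obj (Opposite.op M)).obj N) ↔
      ∀ f : P.complex.X (n + 1) ⟶ N, P.complex.d (n + 2) (n + 1) ≫ f = 0 →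
        ∃ g : P.complex.X n ⟶ N, P.complex.d (n + 1) n ≫ g = f := by
    rw [← ModuleCat.isZero_iff_subsingleton, (P.isoExt (n + 1) N).isZero_iff,
      ← HomologicalComplex.exactAt_iff_isZero_homology,
      HomologicalComplex.exactAt_iff' _ n (n + 1) (n + 2) (by simp) (by simp),
      ShortComplex.moduleCat_exact_iff]
    exact Iff.rfl
  have h2 : Subsingleton (Abelian.Ext.{0} M N (n + 1)) ↔
      ∀ f : P.complex.X (n + 1) ⟶ N, P.complex.d (n + 2) (n + 1) ≫ f = 0 →
        ∃ g : P.complex.X n ⟶ N, P.complex.d (n + 1) n ≫ g = f := by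
    constructor
    · intro hs f hf
      exact (P.extMk_eq_zero_iff f (n + 2) rfl hf n rfl).1 (Subsingleton.elim _ _)
    · intro H
      refine subsingleton_of_forall_eq 0 fun α => ?_
      obtain ⟨f, hf, rfl⟩ := P.extMk_surjective α (n + 2) rfl
      exact (P.extMk_eq_zero_iff f (n + 2) rfl hf n rfl).2 (H f hf)
  rw [h1, h2]

/-- The short complex of modules attached to an exact pair of linear maps. -/
theorem shortExact_of {A : Type} [CommRing A] {M N P : Type}
    [AddCommGroup M] [Module A M] [AddCommGroup N] [Module A N] [AddCommGroup P] [Module A P]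
    (i : M →ₗ[A] N) (p : N →ₗ[A] P) (hi : Function.Injective i) (hp : Function.Surjective p)
    (hex : Function.Exact i p) :
    (ShortComplex.mk (ModuleCat.ofHom i) (ModuleCat.ofHom p)
      (by ext x; exact hex.apply_apply_eq_zero x)).ShortExact where
  exact := by
    rw [ShortComplex.moduleCat_exact_iff]
    intro x hx
    exact (hex x).1 hx
  mono_f := (ModuleCat.mono_iff_injective _).2 hi
  epi_g := (ModuleCat.epi_iff_surjective _).2 hp

/-- Middle term vanishing for `Ext`. -/
theorem ext_middle {A : Type} [CommRing A] {M N P : Type}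
    [AddCommGroup M] [Module A M] [AddCommGroup N] [Module A N] [AddCommGroup P] [Module A P]
    (i : M →ₗ[A] N) (p : N →ₗ[A] P) (hi : Function.Injective i) (hp : Function.Surjective p)
    (hex : Function.Exact i p) (Y : ModuleCat.{0} A)
    (hM : ∀ n : ℕ, 0 < n → Subsingleton (((Ext A (ModuleCat A) n).obj
      (Opposite.op (ModuleCat.of A M))).obj Y))
    (hP : ∀ n : ℕ, 0 < n → Subsingleton (((Ext A (ModuleCat A) n).obj
      (Opposite.op (ModuleCat.of A P))).obj Y)) :
    ∀ n : ℕ, 0 < n → Subsingleton (((Ext A (ModuleCat A) n).obj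
      (Opposite.op (ModuleCat.of A N))).obj Y) := by
  intro n hn
  obtain ⟨n, rfl⟩ := Nat.exists_eq_succ_of_ne_zero hn.ne'
  have hM' := (ext_subsingleton_iff A _ _ n).1 (hM _ hn)
  have hP' := (ext_subsingleton_iff A _ _ n).1 (hP _ hn)
  refine (ext_subsingleton_iff A _ _ n).2 (subsingleton_of_forall_eq 0 fun α => ?_)
  obtain ⟨β, rfl⟩ := Abelian.Ext.contravariant_sequence_exact₂
    (shortExact_of i p hi hp hex) Y α (Subsingleton.elim (α := Abelian.Ext.{0} _ _ _) _ _)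
  have : β = 0 := Subsingleton.elim (α := Abelian.Ext.{0} _ _ _) _ _
  rw [this, Abelian.Ext.comp_zero]

/-- Vanishing of `Ext¹` makes the dual of an injection surjective. -/
theorem dual_surj {A : Type} [CommRing A] {M N P : Type}
    [AddCommGroup M] [Module A M] [AddCommGroup N] [Module A N] [AddCommGroup P] [Module A P]
    (i : M →ₗ[A] N) (p : N →ₗ[A] P) (hi : Function.Injective i) (hp : Function.Surjective p)
    (hex : Function.Exact i p)
    (hP : Subsingleton (((Ext A (ModuleCat A) 1).obj
      (Opposite.op (ModuleCat.of A P))).obj (ModuleCat.of A A))) :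
    Function.Surjective (Module.Dual.transpose (R := A) i) := by
  intro u
  have hP' := (ext_subsingleton_iff A _ _ 0).1 hP
  obtain ⟨β, hβ⟩ := Abelian.Ext.contravariant_sequence_exact₁
    (shortExact_of i p hi hp hex) (ModuleCat.of A A) (Abelian.Ext.mk₀ (ModuleCat.ofHom u))
    (n₁ := 1) rfl (Subsingleton.elim (α := Abelian.Ext.{0} _ _ _) _ _)
  obtain ⟨v, rfl⟩ := (Abelian.Ext.mk₀_bijective _ _).2 β
  rw [Abelian.Ext.mk₀_comp_mk₀] at hβ
  have := (Abelian.Ext.mk₀_bijective _ _).1 hβ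
  refine ⟨v.hom, ?_⟩
  ext x
  exact congrArg (fun w => w.hom x) this

/-- Gorenstein projectives are closed under extensions. -/
theorem IsGP.middle {A : Type} [CommRing A] {M N P : Type}
    [AddCommGroup M] [Module A M] [AddCommGroup N] [Module A N] [AddCommGroup P] [Module A P]
    (i : M →ₗ[A] N) (p : N →ₗ[A] P) (hi : Function.Injective i) (hp : Function.Surjective p)
    (hex : Function.Exact i p) (hM : IsGP A M) (hP : IsGP A P) : IsGP A N := by
  obtain ⟨bM, eM, dM⟩ := hM
  obtain ⟨bP, eP, dP⟩ := hP
  have hs := dual_surj i p hi hp hex (eP 1 one_pos)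
  have hi' : Function.Injective (Module.Dual.transpose (R := A) p) := by
    intro u v huv
    ext x
    obtain ⟨y, rfl⟩ := hp x
    exact LinearMap.congr_fun huv y
  have hpi : ∀ x, p (i x) = 0 := hex.apply_apply_eq_zero
  have hex' : Function.Exact (Module.Dual.transpose (R := A) p)
      (Module.Dual.transpose (R := A) i) := by
    intro u
    constructor
    · intro hu
      have hu' : ∀ x, u (i x) = 0 := fun x => LinearMap.congr_fun hu x
      have hk : LinearMap.ker p ≤ LinearMap.ker u := by
        intro y hy
        obtain ⟨x, rfl⟩ := (hex y).1 hy
        exact hu' x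
      refine ⟨(LinearMap.ker p).liftQ u hk ∘ₗ
        (p.quotKerEquivOfSurjective hp).symm.toLinearMap, ?_⟩
      ext y
      have : (p.quotKerEquivOfSurjective hp).symm (p y) = Submodule.Quotient.mk y := by
        rw [LinearEquiv.symm_apply_eq]; rfl
      simp [Module.Dual.transpose_apply, this]
    · rintro ⟨v, rfl⟩
      ext x
      simp [Module.Dual.transpose_apply, hpi]
  refine ⟨⟨?_, ?_⟩, ext_middle i p hi hp hex _ eM eP, ext_middle _ _ hi' hs hex' _ dP dM⟩
  · rw [injective_iff_map_eq_zero]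
    intro y hy
    have hy' : ∀ u : Module.Dual A N, u y = 0 := fun u => LinearMap.congr_fun hy u
    have : p y = 0 := by
      refine (injective_iff_map_eq_zero _).1 bP.1 _ ?_
      ext u
      exact hy' (u ∘ₗ p)
    obtain ⟨x, rfl⟩ := (hex y).1 this
    have : x = 0 := by
      refine (injective_iff_map_eq_zero _).1 bM.1 _ ?_
      ext u
      obtain ⟨v, rfl⟩ := hs u
      exact hy' v
    rw [this, map_zero]
  · intro ξ
    obtain ⟨c, hc⟩ := bP.2 (ξ ∘ₗ Module.Dual.transpose (R := A) p)
    obtain ⟨b, rfl⟩ := hp c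
    -- the difference kills the image of the dual of `P`, so it comes from the bidual of `M`
    have hd : ∀ w : Module.Dual A P, (ξ - Module.Dual.eval A N b) (w ∘ₗ p) = 0 := by
      intro w
      have := LinearMap.congr_fun hc w
      rw [LinearMap.sub_apply, sub_eq_zero]
      exact this.symm
    let t := Module.Dual.transpose (R := A) i
    have hk : LinearMap.ker t ≤ LinearMap.ker (ξ - Module.Dual.eval A N b) := by
      intro y hy
      obtain ⟨w, rfl⟩ := (hex' y).1 hy
      exact hd w
    obtain ⟨a, ha⟩ := bM.2 ((LinearMap.ker t).liftQ _ hk ∘ₗ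
        (t.quotKerEquivOfSurjective hs).symm.toLinearMap)
    refine ⟨b + i a, ?_⟩
    ext u
    have h1 := LinearMap.congr_fun ha (t u)
    have : (t.quotKerEquivOfSurjective hs).symm (t u) = Submodule.Quotient.mk u := by
      rw [LinearEquiv.symm_apply_eq]; rfl
    rw [LinearMap.comp_apply, LinearEquiv.coe_coe, this, Submodule.liftQ_apply] at h1
    have h2 : u (i a) = ξ u - u b := h1
    change u (b + i a) = ξ u
    rw [map_add, h2]; abel

section Pushout

variable {S : Type} [CommRing S] {A T K : Type}
    [AddCommGroup A] [Module S A] [AddCommGroup T] [Module S T]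
    [AddCommGroup K] [Module S K] (θ : A →ₗ[S] T) (φ : A →ₗ[S] K)

/-- The projection of the pushout onto the cokernel of `φ`. -/
noncomputable def pushoutProj : pushoutMod θ φ →ₗ[S] (K ⧸ LinearMap.range φ) :=
  Submodule.liftQ _ (Submodule.mkQ _ ∘ₗ LinearMap.snd S T K) (by
    rintro _ ⟨a, rfl⟩
    simp)

theorem pushoutProj_mk (t : T) (k : K) :
    pushoutProj θ φ (Submodule.Quotient.mk (t, k)) = Submodule.Quotient.mk k := rfl

theorem pushoutProj_surj : Function.Surjective (pushoutProj θ φ) := by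
  intro x
  obtain ⟨k, rfl⟩ := Submodule.Quotient.mk_surjective _ x
  exact ⟨Submodule.Quotient.mk (0, k), rfl⟩

theorem pushout_exact : Function.Exact (pushoutInl θ φ) (pushoutProj θ φ) := by
  intro x
  constructor
  · obtain ⟨⟨t, k⟩, rfl⟩ := Submodule.Quotient.mk_surjective _ x
    intro hx
    rw [pushoutProj_mk, Submodule.Quotient.mk_eq_zero] at hx
    obtain ⟨a, rfl⟩ := hx
    refine ⟨t + θ a, ?_⟩
    change Submodule.Quotient.mk (t + θ a, (0 : K)) = _
    rw [Submodule.Quotient.eq]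
    exact ⟨a, by simp⟩
  · rintro ⟨t, rfl⟩
    change pushoutProj θ φ (Submodule.Quotient.mk (t, 0)) = 0
    rw [pushoutProj_mk, Submodule.Quotient.mk_zero]

theorem pushoutInl_inj (hφ : Function.Injective φ) : Function.Injective (pushoutInl θ φ) := by
  rw [injective_iff_map_eq_zero]
  intro t ht
  change Submodule.Quotient.mk (t, (0 : K)) = 0 at ht
  rw [Submodule.Quotient.mk_eq_zero] at ht
  obtain ⟨a, ha⟩ := ht
  replace ha : θ a = t ∧ φ a = 0 :=
    ⟨congrArg Prod.fst ha, neg_eq_zero.1 (congrArg Prod.snd ha)⟩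
  have : a = 0 := hφ (by rw [ha.2, map_zero])
  rw [← ha.1, this, map_zero]

/-- The cokernel of `T → pushout` is the cokernel of `φ`. -/
noncomputable def pushoutCokerEquiv :
    (pushoutMod θ φ ⧸ LinearMap.range (pushoutInl θ φ)) ≃ₗ[S] (K ⧸ LinearMap.range φ) :=
  (Submodule.quotEquivOfEq _ _ (pushout_exact θ φ).linearMap_ker_eq.symm).trans
    ((pushoutProj θ φ).quotKerEquivOfSurjective (pushoutProj_surj θ φ))

theorem pushoutCokerEquiv_mk (t : T) (k : K) :
    pushoutCokerEquiv θ φ (Submodule.Quotient.mk (Submodule.Quotient.mk (t, k))) =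
      Submodule.Quotient.mk k := rfl

end Pushout

/-- the pushout of an admissible monic `φ : (f : G1 → G0) → (g : K1 → K0)`
in `Mon(ω, 𝒢)` along an arbitrary morphism `θ : (f : G1 → G0) → (h : T1 → T0)` exists and
yields an admissible monic, with cokernel isomorphic to the cokernel of `φ`. -/
theorem stmt_3 (S : Type) [CommRing S] [IsNoetherianRing S] [IsLocalRing S]
    (ω : S) (hω : ω ∈ IsLocalRing.maximalIdeal S) (hreg : ω ∈ nonZeroDivisors S)
    (G1 G0 K1 K0 T1 T0 : Type)
    [AddCommGroup G1] [Module S G1] [AddCommGroup G0] [Module S G0]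
    [AddCommGroup K1] [Module S K1] [AddCommGroup K0] [Module S K0]
    [AddCommGroup T1] [Module S T1] [AddCommGroup T0] [Module S T0]
    (f : G1 →ₗ[S] G0) (g : K1 →ₗ[S] K0) (h : T1 →ₗ[S] T0)
    (hG : MonObj S ω f) (hK : MonObj S ω g) (hT : MonObj S ω h)
    (φ1 : G1 →ₗ[S] K1) (φ0 : G0 →ₗ[S] K0) (hφc : g ∘ₗ φ1 = φ0 ∘ₗ f)
    (hφ1 : Function.Injective φ1) (hφ0 : Function.Injective φ0)
    (hlMon : MonObj S ω (cokerMap f g φ1 φ0 hφc))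
    (θ1 : G1 →ₗ[S] T1) (θ0 : G0 →ₗ[S] T0) (hθc : h ∘ₗ θ1 = θ0 ∘ₗ f) :
    MonObj S ω (pushoutMap θ1 φ1 θ0 φ0 f h g hθc hφc) ∧
    Function.Injective (pushoutInl θ1 φ1) ∧
    Function.Injective (pushoutInl θ0 φ0) ∧
    ∃ hcomm : (pushoutMap θ1 φ1 θ0 φ0 f h g hθc hφc) ∘ₗ pushoutInl θ1 φ1 =
        (pushoutInl θ0 φ0) ∘ₗ h,
      ∃ (e1 : (pushoutMod θ1 φ1 ⧸ LinearMap.range (pushoutInl θ1 φ1)) ≃ₗ[S]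
            (K1 ⧸ LinearMap.range φ1))
        (e0 : (pushoutMod θ0 φ0 ⧸ LinearMap.range (pushoutInl θ0 φ0)) ≃ₗ[S]
            (K0 ⧸ LinearMap.range φ0)),
        (cokerMap f g φ1 φ0 hφc) ∘ₗ (e1 : _ →ₗ[S] _) =
          (e0 : _ →ₗ[S] _) ∘ₗ
            (cokerMap h (pushoutMap θ1 φ1 θ0 φ0 f h g hθc hφc)
              (pushoutInl θ1 φ1) (pushoutInl θ0 φ0) hcomm) := by
  obtain ⟨fT1, fT0, gT1, gT0, iT, oT⟩ := hT
  obtain ⟨fK1, fK0, gK1, gK0, iK, oK⟩ := hK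
  obtain ⟨fL1, fL0, gL1, gL0, iL, oL⟩ := hlMon
  have c1 := fun x => LinearMap.congr_fun hφc x
  have c2 := fun x => LinearMap.congr_fun hθc x
  simp only [LinearMap.comp_apply] at c1 c2
  refine ⟨⟨inferInstance, inferInstance, ?_, ?_, ?_, ?_⟩, pushoutInl_inj θ1 φ1 hφ1,
    pushoutInl_inj θ0 φ0 hφ0, ?_⟩
  · exact IsGP.middle _ _ (pushoutInl_inj θ1 φ1 hφ1) (pushoutProj_surj θ1 φ1)
      (pushout_exact θ1 φ1) gT1 gL1
  · exact IsGP.middle _ _ (pushoutInl_inj θ0 φ0 hφ0) (pushoutProj_surj θ0 φ0)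
      (pushout_exact θ0 φ0) gT0 gL0
  · rw [injective_iff_map_eq_zero]
    intro x hx
    obtain ⟨⟨t, k⟩, rfl⟩ := Submodule.Quotient.mk_surjective _ x
    change Submodule.Quotient.mk (h t, g k) = 0 at hx
    rw [Submodule.Quotient.mk_eq_zero] at hx
    obtain ⟨a, ha⟩ := hx
    have h1 : θ0 a = h t := congrArg Prod.fst ha
    have h2 : -φ0 a = g k := congrArg Prod.snd ha
    have hk : (Submodule.Quotient.mk k : K1 ⧸ LinearMap.range φ1) = 0 := by
      refine (injective_iff_map_eq_zero _).1 iL _ ?_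
      change Submodule.Quotient.mk (g k) = 0
      rw [Submodule.Quotient.mk_eq_zero]
      exact ⟨-a, by rw [map_neg, h2]⟩
    rw [Submodule.Quotient.mk_eq_zero] at hk
    obtain ⟨b, rfl⟩ := hk
    have hab : a = f (-b) := by
      apply hφ0
      rw [← c1, map_neg, map_neg, ← h2, neg_neg]
    rw [Submodule.Quotient.mk_eq_zero]
    refine ⟨-b, ?_⟩
    have : θ1 (-b) = t := iT (by rw [c2, ← hab, h1])
    simp [LinearMap.prod_apply, ← this]
  · intro y
    obtain ⟨⟨t, k⟩, rfl⟩ := Submodule.Quotient.mk_surjective _ y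
    obtain ⟨t', ht⟩ := oT t
    obtain ⟨k', hk⟩ := oK k
    refine ⟨Submodule.Quotient.mk (t', k'), ?_⟩
    change Submodule.Quotient.mk (h t', g k') = _
    rw [ht, hk]
    rfl
  · have hcomm : (pushoutMap θ1 φ1 θ0 φ0 f h g hθc hφc) ∘ₗ pushoutInl θ1 φ1 =
        (pushoutInl θ0 φ0) ∘ₗ h := by
      refine LinearMap.ext fun t => ?_
      change Submodule.Quotient.mk (h t, g 0) = Submodule.Quotient.mk (h t, 0)
      rw [map_zero]
    refine ⟨hcomm, pushoutCokerEquiv θ1 φ1, pushoutCokerEquiv θ0 φ0, ?_⟩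
    refine LinearMap.ext fun x => ?_
    obtain ⟨x, rfl⟩ := Submodule.Quotient.mk_surjective _ x
    obtain ⟨⟨t, k⟩, rfl⟩ := Submodule.Quotient.mk_surjective _ x
    rfl
end

section
/- Let ψ = (ψ1,ψ0): (g: G1 → G0) → (h: H1 → H0) be a morphism in Mon(ω,𝒢) with ψ1 and ψ0 surjective, and let e: E1 → E0 be the map induced on componentwise kernels E_i = Ker ψ_i. Then (e: E1 → E0) is an object of Mon(ω,𝒢): E1 and E0 are finitely generated Gorenstein projective S-modules, e is injective, and ω·(Coker e) = 0. In other words, Mon(ω,𝒢) is closed under kernels of componentwise epimorphisms. -/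
open CategoryTheory LinearMap Function

namespace MonKer

/-- The derived-functor `Ext` vanishes iff the derived-category `Ext` vanishes. -/
lemma ext_bridge (A : Type) [CommRing A] (X Y : ModuleCat.{0} A) (n : ℕ) :
    Subsingleton (((_root_.Ext A (ModuleCat.{0} A) (n + 1)).obj (Opposite.op X)).obj Y) ↔
      Subsingleton (Abelian.Ext.{0} X Y (n + 1)) := by
  let P := projectiveResolution X
  have h1 : Subsingleton (((_root_.Ext A (ModuleCat.{0} A) (n + 1)).obj (Opposite.op X)).obj Y) ↔
      ∀ f : P.complex.X (n + 1) ⟶ Y, P.complex.d (n + 2) (n + 1) ≫ f = 0 →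
        ∃ g : P.complex.X n ⟶ Y, P.complex.d (n + 1) n ≫ g = f := by
    rw [← ModuleCat.isZero_iff_subsingleton, (P.isoExt (n + 1) Y).isZero_iff,
      ← HomologicalComplex.exactAt_iff_isZero_homology,
      HomologicalComplex.exactAt_iff' _ n (n + 1) (n + 2) (by simp) (by simp),
      ShortComplex.moduleCat_exact_iff]
    rfl
  rw [h1]
  constructor
  · intro h
    refine subsingleton_of_forall_eq 0 fun α => ?_
    obtain ⟨f, hf, rfl⟩ := P.extMk_surjective α (n + 2) rfl
    rw [P.extMk_eq_zero_iff f (n + 2) rfl hf n rfl]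
    exact h f hf
  · intro h f hf
    rw [← P.extMk_eq_zero_iff f (n + 2) rfl hf n rfl]
    exact Subsingleton.elim _ _

variable {A : Type} [CommRing A] {S : ShortComplex (ModuleCat.{0} A)}
  {Y : ModuleCat.{0} A}

lemma van1 (hS : S.ShortExact) (n : ℕ) (h2 : Subsingleton (Abelian.Ext.{0} S.X₂ Y n))
    (h3 : Subsingleton (Abelian.Ext.{0} S.X₃ Y (n + 1))) :
    Subsingleton (Abelian.Ext.{0} S.X₁ Y n) := by
  refine subsingleton_of_forall_eq 0 fun α => ?_
  obtain ⟨x, rfl⟩ := Abelian.Ext.contravariant_sequence_exact₁ hS Y α (add_comm 1 n)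
    (Subsingleton.elim _ _)
  rw [Subsingleton.elim x 0, Abelian.Ext.comp_zero]

lemma van3 (hS : S.ShortExact) (n : ℕ) (h1 : Subsingleton (Abelian.Ext.{0} S.X₁ Y n))
    (h2 : Subsingleton (Abelian.Ext.{0} S.X₂ Y (n + 1))) :
    Subsingleton (Abelian.Ext.{0} S.X₃ Y (n + 1)) := by
  refine subsingleton_of_forall_eq 0 fun α => ?_
  obtain ⟨x, rfl⟩ := Abelian.Ext.contravariant_sequence_exact₃ hS Y α
    (Subsingleton.elim _ _) (add_comm 1 n)
  rw [Subsingleton.elim x 0, Abelian.Ext.comp_zero]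

lemma extend (hS : S.ShortExact) (h3 : Subsingleton (Abelian.Ext.{0} S.X₃ Y 1)) (f : S.X₁ ⟶ Y) :
    ∃ g : S.X₂ ⟶ Y, S.f ≫ g = f := by
  obtain ⟨x, hx⟩ := Abelian.Ext.contravariant_sequence_exact₁ hS Y (Abelian.Ext.mk₀ f)
    (add_zero 1) (Subsingleton.elim _ _)
  obtain ⟨g, rfl⟩ := (Abelian.Ext.mk₀_bijective _ _).2 x
  refine ⟨g, (Abelian.Ext.mk₀_bijective _ _).1 ?_⟩
  rw [← hx, Abelian.Ext.mk₀_comp_mk₀]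

lemma van3' (hS : S.ShortExact) (h1 : ∀ f : S.X₁ ⟶ Y, ∃ g : S.X₂ ⟶ Y, S.f ≫ g = f)
    (h2 : Subsingleton (Abelian.Ext.{0} S.X₂ Y 1)) :
    Subsingleton (Abelian.Ext.{0} S.X₃ Y 1) := by
  refine subsingleton_of_forall_eq 0 fun α => ?_
  obtain ⟨x, rfl⟩ := Abelian.Ext.contravariant_sequence_exact₃ hS Y α
    (Subsingleton.elim _ _) (add_zero 1)
  obtain ⟨f, rfl⟩ := (Abelian.Ext.mk₀_bijective _ _).2 x
  obtain ⟨g, rfl⟩ := h1 f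
  rw [← Abelian.Ext.mk₀_comp_mk₀, ShortComplex.ShortExact.extClass_comp_assoc]

lemma isGP_iff (M : Type) [AddCommGroup M] [Module A M] : IsGP A M ↔
    Function.Bijective (Module.Dual.eval A M) ∧
    (∀ n : ℕ, Subsingleton (Abelian.Ext.{0} (ModuleCat.of A M) (ModuleCat.of A A) (n + 1))) ∧
    (∀ n : ℕ, Subsingleton
      (Abelian.Ext.{0} (ModuleCat.of A (Module.Dual A M)) (ModuleCat.of A A) (n + 1))) := by
  simp only [← ext_bridge]
  refine and_congr Iff.rfl (and_congr ?_ ?_) <;>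
  · refine ⟨fun h n => h (n + 1) n.succ_pos, fun h i hi => ?_⟩
    obtain ⟨n, rfl⟩ := Nat.exists_eq_succ_of_ne_zero hi.ne'
    exact h n

lemma isGP_ker {G H : Type} [AddCommGroup G] [Module A G] [AddCommGroup H] [Module A H]
    (hG : IsGP A G) (hH : IsGP A H) (ψ : G →ₗ[A] H) (hs : Function.Surjective ψ) :
    IsGP A (LinearMap.ker ψ) := by
  rw [isGP_iff] at hG hH ⊢
  obtain ⟨bG, eG, dG⟩ := hG
  obtain ⟨bH, eH, dH⟩ := hH
  let i := (LinearMap.ker ψ).subtype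
  let S₁ : ShortComplex (ModuleCat.{0} A) := ShortComplex.mk (ModuleCat.ofHom i)
    (ModuleCat.ofHom ψ) (by ext x; exact x.2)
  have hS₁ : S₁.ShortExact := ModuleCat.shortComplex_shortExact S₁
    (LinearMap.exact_subtype_ker_map ψ) (Submodule.injective_subtype _) hs
  have surj : Function.Surjective i.dualMap := by
    intro f
    obtain ⟨g, hg⟩ := extend hS₁ (eH 0) (ModuleCat.ofHom f)
    exact ⟨g.hom, congrArg ModuleCat.Hom.hom hg⟩
  have hcomp : ∀ f, i.dualMap (ψ.dualMap f) = 0 := by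
    intro f
    ext x
    have : ψ x = 0 := x.2
    simp [i, this]
  have inj : Function.Injective ψ.dualMap := LinearMap.dualMap_injective_of_surjective hs
  have ex : Function.Exact ψ.dualMap i.dualMap := by
    intro f
    constructor
    · intro hf
      have hk : LinearMap.ker ψ ≤ LinearMap.ker f := fun x hx =>
        LinearMap.congr_fun hf ⟨x, hx⟩
      let e := ψ.quotKerEquivOfSurjective hs
      refine ⟨((LinearMap.ker ψ).liftQ f hk) ∘ₗ e.symm.toLinearMap, ?_⟩
      ext x
      have : e.symm (ψ x) = Submodule.Quotient.mk x := by
        rw [LinearEquiv.symm_apply_eq]; rfl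
      simp [this]
    · rintro ⟨f, rfl⟩
      exact hcomp f
  let S₂ : ShortComplex (ModuleCat.{0} A) := ShortComplex.mk (ModuleCat.ofHom ψ.dualMap)
    (ModuleCat.ofHom i.dualMap) (by ext x : 2; exact hcomp x)
  have hS₂ : S₂.ShortExact := ModuleCat.shortComplex_shortExact S₂ ex inj surj
  refine ⟨⟨?_, ?_⟩, fun n => van1 hS₁ _ (eG n) (eH (n + 1)), fun n => ?_⟩
  · rw [injective_iff_map_eq_zero]
    intro x hx
    have : Module.Dual.eval A G (i x) = 0 := by
      ext f
      exact LinearMap.congr_fun hx (i.dualMap f)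
    exact Subtype.ext ((injective_iff_map_eq_zero _).1 bG.1 _ this)
  · intro Φ
    obtain ⟨x, hx⟩ := bG.2 (Φ ∘ₗ i.dualMap)
    have hx0 : ψ x = 0 := by
      apply bH.1
      ext f
      have := LinearMap.congr_fun hx (ψ.dualMap f)
      rw [LinearMap.comp_apply, hcomp, map_zero] at this
      simpa using this
    refine ⟨⟨x, hx0⟩, ?_⟩
    ext f
    obtain ⟨f, rfl⟩ := surj f
    exact LinearMap.congr_fun hx f
  · cases n with
    | zero =>
      refine van3' hS₂ (fun f => ?_) (dG 0)
      obtain ⟨y, hy⟩ := bH.2 f.hom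
      obtain ⟨x, rfl⟩ := hs y
      refine ⟨ModuleCat.ofHom (Module.Dual.eval A G x), ?_⟩
      ext k : 2
      exact LinearMap.congr_fun hy k
    | succ n => exact van3 hS₂ _ (dH n) (dG (n + 1))

end MonKer

/-- `Mon(ω, 𝒢)` is closed under kernels of componentwise epimorphisms:
if `(ψ1, ψ0) : (g : G1 → G0) → (h : H1 → H0)` is a morphism in `Mon(ω, 𝒢)` with `ψ1, ψ0`
surjective, then the induced map `e : Ker ψ1 → Ker ψ0` is an object of `Mon(ω, 𝒢)`. -/
theorem stmt_4 (S : Type) [CommRing S] [IsNoetherianRing S] [IsLocalRing S]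
    (ω : S) (hω : ω ∈ IsLocalRing.maximalIdeal S) (hreg : ω ∈ nonZeroDivisors S)
    (G1 G0 H1 H0 : Type)
    [AddCommGroup G1] [Module S G1] [AddCommGroup G0] [Module S G0]
    [AddCommGroup H1] [Module S H1] [AddCommGroup H0] [Module S H0]
    (g : G1 →ₗ[S] G0) (h : H1 →ₗ[S] H0)
    (hG : MonObj S ω g) (hH : MonObj S ω h)
    (ψ1 : G1 →ₗ[S] H1) (ψ0 : G0 →ₗ[S] H0) (hc : h ∘ₗ ψ1 = ψ0 ∘ₗ g)
    (hs1 : Function.Surjective ψ1) (hs0 : Function.Surjective ψ0) :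
    MonObj S ω
      (g.restrict (p := LinearMap.ker ψ1) (q := LinearMap.ker ψ0) (fun x hx => by
        have e := LinearMap.congr_fun hc x
        simp only [LinearMap.comp_apply] at e
        simp only [LinearMap.mem_ker] at hx ⊢
        rw [← e, hx, map_zero])) := by
  obtain ⟨fG1, fG0, gG1, gG0, ig, og⟩ := hG
  obtain ⟨fH1, fH0, gH1, gH0, ih, oh⟩ := hH
  refine ⟨inferInstance, inferInstance, MonKer.isGP_ker gG1 gH1 ψ1 hs1,
    MonKer.isGP_ker gG0 gH0 ψ0 hs0, ?_, ?_⟩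
  · intro x y hxy
    exact Subtype.ext (ig (congrArg Subtype.val hxy))
  · rintro ⟨y, hy⟩
    obtain ⟨x, hx⟩ := og y
    have e := LinearMap.congr_fun hc x
    simp only [LinearMap.comp_apply] at e
    have hx1 : ψ1 x = 0 := by
      apply ih
      rw [e, hx, map_smul, LinearMap.mem_ker.1 hy, smul_zero, map_zero]
    exact ⟨⟨x, hx1⟩, Subtype.ext hx⟩
end

section
/- Let P be a finitely generated projective S-module. Then (id: P → P) and (ω: P → P) are projective objects of Mon(ω,𝒢): for every short exact sequence 0 → (e1: E1 → E0) → (g1: G1 → G0) →^{φ} (id: P → P) → 0 in Mon(ω,𝒢) there is a morphism ψ: (id: P → P) → (g1: G1 → G0) with φ∘ψ the identity, and likewise for every short exact sequence in Mon(ω,𝒢) ending at (ω: P → P). -/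
open CategoryTheory LinearMap Function

/-- for a finitely generated projective `S`-module `P`, the objects
`(id : P → P)` and `(ω : P → P)` are projective objects of `Mon(ω, 𝒢)`: every
conflation of `Mon(ω, 𝒢)` ending at them admits a section. -/
theorem stmt_5 (S : Type) [CommRing S] [IsNoetherianRing S] [IsLocalRing S]
    (ω : S) (hω : ω ∈ IsLocalRing.maximalIdeal S) (hreg : ω ∈ nonZeroDivisors S)
    (P : Type) [AddCommGroup P] [Module S P]
    (hPfin : Module.Finite S P) (hPproj : Module.Projective S P) :
    (∀ (E1 E0 G1 G0 : ModuleCat S) (e1 : E1 →ₗ[S] E0) (g1 : G1 →ₗ[S] G0)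
        (α1 : E1 →ₗ[S] G1) (α0 : E0 →ₗ[S] G0)
        (φ1 : G1 →ₗ[S] P) (φ0 : G0 →ₗ[S] P),
      MonObj S ω e1 → MonObj S ω g1 →
      MonObj S ω (LinearMap.id : P →ₗ[S] P) →
      g1 ∘ₗ α1 = α0 ∘ₗ e1 →
      (LinearMap.id : P →ₗ[S] P) ∘ₗ φ1 = φ0 ∘ₗ g1 →
      Function.Injective α1 → Function.Injective α0 →
      Function.Exact α1 φ1 → Function.Exact α0 φ0 →
      Function.Surjective φ1 → Function.Surjective φ0 →
      ∃ (ψ1 : P →ₗ[S] G1) (ψ0 : P →ₗ[S] G0),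
        g1 ∘ₗ ψ1 = ψ0 ∘ₗ (LinearMap.id : P →ₗ[S] P) ∧
        φ1 ∘ₗ ψ1 = LinearMap.id ∧ φ0 ∘ₗ ψ0 = LinearMap.id) ∧
    (∀ (E1 E0 G1 G0 : ModuleCat S) (e1 : E1 →ₗ[S] E0) (g1 : G1 →ₗ[S] G0)
        (α1 : E1 →ₗ[S] G1) (α0 : E0 →ₗ[S] G0)
        (φ1 : G1 →ₗ[S] P) (φ0 : G0 →ₗ[S] P),
      MonObj S ω e1 → MonObj S ω g1 →
      MonObj S ω (ω • (LinearMap.id : P →ₗ[S] P)) →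
      g1 ∘ₗ α1 = α0 ∘ₗ e1 →
      (ω • (LinearMap.id : P →ₗ[S] P)) ∘ₗ φ1 = φ0 ∘ₗ g1 →
      Function.Injective α1 → Function.Injective α0 →
      Function.Exact α1 φ1 → Function.Exact α0 φ0 →
      Function.Surjective φ1 → Function.Surjective φ0 →
      ∃ (ψ1 : P →ₗ[S] G1) (ψ0 : P →ₗ[S] G0),
        g1 ∘ₗ ψ1 = ψ0 ∘ₗ (ω • (LinearMap.id : P →ₗ[S] P)) ∧
        φ1 ∘ₗ ψ1 = LinearMap.id ∧ φ0 ∘ₗ ψ0 = LinearMap.id) := by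
  refine ⟨?_, ?_⟩
  · intro E1 E0 G1 G0 e1 g1 α1 α0 φ1 φ0 _ _ _ _ hφ _ _ _ _ hs1 _
    obtain ⟨ψ1, h1⟩ := Module.projective_lifting_property φ1 LinearMap.id hs1
    refine ⟨ψ1, g1 ∘ₗ ψ1, rfl, h1, ?_⟩
    rw [← LinearMap.comp_assoc, ← hφ, LinearMap.id_comp, h1]
  · intro E1 E0 G1 G0 e1 g1 α1 α0 φ1 φ0 _ hg hP _ hφ _ _ _ _ _ hs0
    obtain ⟨ψ0, h0⟩ := Module.projective_lifting_property φ0 LinearMap.id hs0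
    obtain ⟨-, -, -, -, ginj, grange⟩ := hg
    obtain ⟨-, -, -, -, pinj, -⟩ := hP
    let e := LinearEquiv.ofInjective g1 ginj
    let ψ1 : P →ₗ[S] G1 := e.symm.toLinearMap ∘ₗ
      LinearMap.codRestrict (LinearMap.range g1) (ω • ψ0) (fun p => grange (ψ0 p))
    have key : ∀ p, g1 (ψ1 p) = ω • ψ0 p := by
      intro p
      exact congrArg Subtype.val (e.apply_symm_apply ⟨ω • ψ0 p, grange (ψ0 p)⟩)
    refine ⟨ψ1, ψ0, ?_, ?_, h0⟩
    · ext p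
      simp [key]
    · ext p
      apply pinj
      have h2 := LinearMap.congr_fun hφ (ψ1 p)
      have h3 := LinearMap.congr_fun h0 p
      simp only [LinearMap.comp_apply, key, map_smul, LinearMap.id_apply] at h2 h3 ⊢
      rw [h2, h3]
      simp
end

section
/- Let P be a finitely generated projective S-module. Then (id: P → P) and (ω: P → P) are injective objects of Mon(ω,𝒢): for every short exact sequence 0 → (ω: P → P) →^{φ} (e1: E1 → E0) → (g1: G1 → G0) → 0 in Mon(ω,𝒢) there is a morphism ψ: (e1: E1 → E0) → (ω: P → P) with ψ∘φ the identity, and likewise for every short exact sequence in Mon(ω,𝒢) beginning at (id: P → P). -/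
open CategoryTheory LinearMap Function

lemma aux_res (S : Type) [CommRing S] (G Y : ModuleCat.{0} S)
    (h : Subsingleton (((Ext S (ModuleCat S) 1).obj (Opposite.op G)).obj Y)) :
    ∃ (Q2 Q1 Q0 : ModuleCat.{0} S) (d2 : Q2 →ₗ[S] Q1) (d1 : Q1 →ₗ[S] Q0) (p : Q0 →ₗ[S] G),
      Module.Projective S Q1 ∧ Module.Projective S Q0 ∧ Function.Surjective p ∧
      Function.Exact d1 p ∧ d1 ∘ₗ d2 = 0 ∧
      ∀ a : Q1 →ₗ[S] Y, a ∘ₗ d2 = 0 → ∃ b : Q0 →ₗ[S] Y, b ∘ₗ d1 = a := by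
  let Q := ProjectiveResolution.of G
  have hz : Limits.IsZero ((Q.complex.linearYonedaObj S Y).homology 1) :=
    Limits.IsZero.of_iso (ModuleCat.isZero_of_subsingleton _) (Q.isoExt 1 Y).symm
  rw [← HomologicalComplex.exactAt_iff_isZero_homology,
    HomologicalComplex.exactAt_iff' _ 0 1 2 (by simp) (by simp),
    ShortComplex.moduleCat_exact_iff] at hz
  refine ⟨Q.complex.X 2, Q.complex.X 1, Q.complex.X 0, (Q.complex.d 2 1).hom,
    (Q.complex.d 1 0).hom, (Q.π.f 0).hom,
    (IsProjective.iff_projective _).2 (Q.projective 1),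
    (IsProjective.iff_projective _).2 (Q.projective 0), ?_, ?_, ?_, ?_⟩
  · exact (ModuleCat.epi_iff_surjective _).1 (inferInstanceAs (Epi (Q.π.f 0)))
  · exact (ShortComplex.ShortExact.moduleCat_exact_iff_function_exact _).1 Q.exact₀
  · rw [← ModuleCat.hom_comp, Q.complex.d_comp_d]; rfl
  · intro a ha
    obtain ⟨b, hb⟩ := hz (ModuleCat.ofHom a) (by
      change Q.complex.d 2 1 ≫ ModuleCat.ofHom a = 0
      ext1
      exact ha)
    change Q.complex.X 0 ⟶ Y at b
    change Q.complex.d 1 0 ≫ b = ModuleCat.ofHom a at hb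
    exact ⟨b.hom, congrArg ModuleCat.Hom.hom hb⟩

lemma aux_ext (S : Type) [CommRing S] (P : Type) [AddCommGroup P] [Module S P]
    (E G Y : ModuleCat.{0} S)
    (h : Subsingleton (((Ext S (ModuleCat S) 1).obj (Opposite.op G)).obj Y))
    (φ : P →ₗ[S] E) (ρ : E →ₗ[S] G) (hφ : Function.Injective φ) (hex : Function.Exact φ ρ)
    (hρ : Function.Surjective ρ) (a : P →ₗ[S] Y) : ∃ c : E →ₗ[S] Y, c ∘ₗ φ = a := by
  obtain ⟨Q2, Q1, Q0, d2, d1, p, hp1, hp0, hps, hpe, hd, hH⟩ := aux_res S G Y h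
  obtain ⟨t, ht⟩ := Module.projective_lifting_property ρ p hρ
  have ht' : ∀ x, ρ (t x) = p x := fun x => LinearMap.congr_fun ht x
  have hmem : ∀ x, t (d1 x) ∈ LinearMap.range φ := fun x => by
    have : ρ (t (d1 x)) = 0 := by rw [ht', hpe.apply_apply_eq_zero]
    exact (hex _).1 this
  let e := LinearEquiv.ofInjective φ hφ
  let s : Q1 →ₗ[S] P := e.symm.toLinearMap ∘ₗ (t ∘ₗ d1).codRestrict (LinearMap.range φ) hmem
  have hs : ∀ x, φ (s x) = t (d1 x) := fun x => by
    have := congrArg Subtype.val (e.apply_symm_apply ⟨t (d1 x), hmem x⟩)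
    exact this
  obtain ⟨b, hb⟩ := hH (a ∘ₗ s) (by
    ext x
    have h1 : s (d2 x) = 0 := hφ (by
      rw [hs, map_zero, show d1 (d2 x) = 0 from LinearMap.congr_fun hd x, map_zero])
    simp [h1])
  have hb' : ∀ x, b (d1 x) = a (s x) := fun x => LinearMap.congr_fun hb x
  let u : (P × Q0) →ₗ[S] E := φ.coprod t
  let v : (P × Q0) →ₗ[S] Y := a.coprod b
  have hu : Function.Surjective u := fun y => by
    obtain ⟨q, hq⟩ := hps (ρ y)
    obtain ⟨x, hx⟩ := (hex (y - t q)).1 (by rw [map_sub, ht', hq, sub_self])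
    exact ⟨(x, q), by simp [u, hx]⟩
  have hk : LinearMap.ker u ≤ LinearMap.ker v := by
    rintro ⟨x, q⟩ hxq
    have hxq' : φ x + t q = 0 := by simpa [u] using hxq
    have hq : p q = 0 := by
      have := congrArg ρ hxq'
      rwa [map_add, hex.apply_apply_eq_zero, zero_add, ht', map_zero] at this
    obtain ⟨w, rfl⟩ := (hpe q).1 hq
    have : x = - s w := hφ (by rw [map_neg, hs]; exact eq_neg_of_add_eq_zero_left hxq')
    simp [v, this, hb']
  let c : E →ₗ[S] Y := (LinearMap.ker u).liftQ v hk ∘ₗ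
    (u.quotKerEquivOfSurjective hu).symm.toLinearMap
  refine ⟨c, ?_⟩
  ext x
  have h2 : (u.quotKerEquivOfSurjective hu).symm (φ x) = (LinearMap.ker u).mkQ (x, 0) := by
    rw [LinearEquiv.symm_apply_eq]
    simp [u]
  change (LinearMap.ker u).liftQ v hk ((u.quotKerEquivOfSurjective hu).symm (φ x)) = a x
  rw [h2]
  simp [v]

lemma aux_split (S : Type) [CommRing S] (P : Type) [AddCommGroup P] [Module S P]
    (hPfin : Module.Finite S P) (hPproj : Module.Projective S P)
    (E G : ModuleCat.{0} S) (h : IsGP S G)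
    (φ : P →ₗ[S] E) (ρ : E →ₗ[S] G) (hφ : Function.Injective φ) (hex : Function.Exact φ ρ)
    (hρ : Function.Surjective ρ) : ∃ c : E →ₗ[S] P, c ∘ₗ φ = LinearMap.id := by
  obtain ⟨n, f, g, -, -, hfg⟩ := Module.Finite.exists_comp_eq_id_of_projective S P
  have := fun i : Fin n => aux_ext S P E G (ModuleCat.of S S) (h.2.1 1 one_pos) φ ρ hφ hex hρ
    (LinearMap.proj i ∘ₗ g)
  choose c hc using this
  refine ⟨f ∘ₗ LinearMap.pi c, ?_⟩
  rw [← hfg, LinearMap.comp_assoc]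
  congr 1
  ext x i
  exact LinearMap.congr_fun (hc i) x

/-- for a finitely generated projective `S`-module `P`, the objects
`(id : P → P)` and `(ω : P → P)` are injective objects of `Mon(ω, 𝒢)`: every
conflation of `Mon(ω, 𝒢)` beginning at them admits a retraction. -/
theorem stmt_6 (S : Type) [CommRing S] [IsNoetherianRing S] [IsLocalRing S]
    (ω : S) (hω : ω ∈ IsLocalRing.maximalIdeal S) (hreg : ω ∈ nonZeroDivisors S)
    (P : Type) [AddCommGroup P] [Module S P]
    (hPfin : Module.Finite S P) (hPproj : Module.Projective S P) :
    (∀ (E1 E0 G1 G0 : ModuleCat S) (e1 : E1 →ₗ[S] E0) (g1 : G1 →ₗ[S] G0)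
        (φ1 : P →ₗ[S] E1) (φ0 : P →ₗ[S] E0)
        (ρ1 : E1 →ₗ[S] G1) (ρ0 : E0 →ₗ[S] G0),
      MonObj S ω (ω • (LinearMap.id : P →ₗ[S] P)) →
      MonObj S ω e1 → MonObj S ω g1 →
      e1 ∘ₗ φ1 = φ0 ∘ₗ (ω • (LinearMap.id : P →ₗ[S] P)) →
      g1 ∘ₗ ρ1 = ρ0 ∘ₗ e1 →
      Function.Injective φ1 → Function.Injective φ0 →
      Function.Exact φ1 ρ1 → Function.Exact φ0 ρ0 →
      Function.Surjective ρ1 → Function.Surjective ρ0 →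
      ∃ (ψ1 : E1 →ₗ[S] P) (ψ0 : E0 →ₗ[S] P),
        (ω • (LinearMap.id : P →ₗ[S] P)) ∘ₗ ψ1 = ψ0 ∘ₗ e1 ∧
        ψ1 ∘ₗ φ1 = LinearMap.id ∧ ψ0 ∘ₗ φ0 = LinearMap.id) ∧
    (∀ (E1 E0 G1 G0 : ModuleCat S) (e1 : E1 →ₗ[S] E0) (g1 : G1 →ₗ[S] G0)
        (φ1 : P →ₗ[S] E1) (φ0 : P →ₗ[S] E0)
        (ρ1 : E1 →ₗ[S] G1) (ρ0 : E0 →ₗ[S] G0),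
      MonObj S ω (LinearMap.id : P →ₗ[S] P) →
      MonObj S ω e1 → MonObj S ω g1 →
      e1 ∘ₗ φ1 = φ0 ∘ₗ (LinearMap.id : P →ₗ[S] P) →
      g1 ∘ₗ ρ1 = ρ0 ∘ₗ e1 →
      Function.Injective φ1 → Function.Injective φ0 →
      Function.Exact φ1 ρ1 → Function.Exact φ0 ρ0 →
      Function.Surjective ρ1 → Function.Surjective ρ0 →
      ∃ (ψ1 : E1 →ₗ[S] P) (ψ0 : E0 →ₗ[S] P),
        (LinearMap.id : P →ₗ[S] P) ∘ₗ ψ1 = ψ0 ∘ₗ e1 ∧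
        ψ1 ∘ₗ φ1 = LinearMap.id ∧ ψ0 ∘ₗ φ0 = LinearMap.id) := by
  refine ⟨?_, ?_⟩
  · intro E1 E0 G1 G0 e1 g1 φ1 φ0 ρ1 ρ0 _ hE hG hφ hρ i1 i0 x1 x0 s1 s0
    obtain ⟨ψ1, hψ⟩ := aux_split S P hPfin hPproj E1 G1 hG.2.2.1 φ1 ρ1 i1 x1 s1
    have hinj := hE.2.2.2.2.1
    have hmem := hE.2.2.2.2.2
    let e := LinearEquiv.ofInjective e1 hinj
    let k : E0 →ₗ[S] E1 := e.symm.toLinearMap ∘ₗ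
      (ω • (LinearMap.id : E0 →ₗ[S] E0)).codRestrict (LinearMap.range e1) hmem
    have hk : ∀ y, e1 (k y) = ω • y := fun y =>
      congrArg Subtype.val (e.apply_symm_apply ⟨ω • y, hmem y⟩)
    refine ⟨ψ1, ψ1 ∘ₗ k, ?_, hψ, ?_⟩
    · ext x
      have : k (e1 x) = ω • x := hinj (by rw [hk, map_smul])
      simp [this]
    · ext x
      have h1 : k (φ0 x) = φ1 x := hinj (by
        rw [hk]
        have := LinearMap.congr_fun hφ x
        simp only [LinearMap.comp_apply, LinearMap.smul_apply, LinearMap.id_apply,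
          map_smul] at this
        exact this.symm)
      have h2 := LinearMap.congr_fun hψ x
      simpa [h1] using h2
  · intro E1 E0 G1 G0 e1 g1 φ1 φ0 ρ1 ρ0 _ hE hG hφ hρ i1 i0 x1 x0 s1 s0
    obtain ⟨ψ0, hψ⟩ := aux_split S P hPfin hPproj E0 G0 hG.2.2.2.1 φ0 ρ0 i0 x0 s0
    refine ⟨ψ0 ∘ₗ e1, ψ0, rfl, ?_, hψ⟩
    rw [LinearMap.comp_assoc, hφ]
    exact hψ
end

section
/- Mon(ω,𝒢) has enough projectives: for every object (g1: G1 → G0) of Mon(ω,𝒢) there exist finitely generated projective S-modules P1, P0 and a morphism φ = (φ1,φ0): (id_{P1} ⊕ ω: P1 ⊕ P0 → P1 ⊕ P0) → (g1: G1 → G0) in Mon(ω,𝒢) such that φ1 and φ0 are surjective and the induced map on componentwise kernels is an object of Mon(ω,𝒢); that is, φ is an admissible epic from a projective object. -/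
open CategoryTheory LinearMap Function

lemma gp_hasExt (S : Type) [CommRing S] : HasExt.{0} (ModuleCat.{0} S) :=
  CategoryTheory.hasExt_of_enoughProjectives _

attribute [local instance] gp_hasExt

/-- Vanishing of the derived-functor `Ext` agrees with vanishing of `Abelian.Ext`. -/
lemma gp_ext_bridge (S : Type) [CommRing S] (X Y : ModuleCat.{0} S) (n : ℕ) :
    Subsingleton (((Ext S (ModuleCat S) (n+1)).obj (Opposite.op X)).obj Y) ↔
      Subsingleton (Abelian.Ext X Y (n+1)) := by
  let P : ProjectiveResolution X := projectiveResolution X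
  trans (∀ f : P.complex.X (n+1) ⟶ Y, P.complex.d (n+2) (n+1) ≫ f = 0 →
      ∃ g : P.complex.X n ⟶ Y, P.complex.d (n+1) n ≫ g = f)
  · rw [← ModuleCat.isZero_iff_subsingleton, (P.isoExt (R := S) (n+1) Y).isZero_iff,
      ← HomologicalComplex.exactAt_iff_isZero_homology,
      HomologicalComplex.exactAt_iff' _ n (n+1) (n+2) (by simp) (by simp),
      ShortComplex.moduleCat_exact_iff]
    rfl
  · constructor
    · intro h
      refine subsingleton_of_forall_eq 0 fun α => ?_
      obtain ⟨f, hf, rfl⟩ := P.extMk_surjective α (n+2) rfl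
      exact (P.extMk_eq_zero_iff f (n+2) rfl hf n rfl).2 (h f hf)
    · intro h f hf
      exact (P.extMk_eq_zero_iff f (n+2) rfl hf n rfl).1 (Subsingleton.elim _ _)

section
variable {S : Type} [CommRing S] {K P G : Type} [AddCommGroup K] [Module S K]
  [AddCommGroup P] [Module S P] [AddCommGroup G] [Module S G]

/-- The short complex of a pair of linear maps with zero composite. -/
def gpSC (i : K →ₗ[S] P) (p : P →ₗ[S] G) (h : Function.Exact i p) :
    ShortComplex (ModuleCat.{0} S) :=
  ShortComplex.mk (ModuleCat.ofHom i) (ModuleCat.ofHom p) (by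
    ext x; exact h.apply_apply_eq_zero x)

lemma gpSC_shortExact (i : K →ₗ[S] P) (p : P →ₗ[S] G) (h : Function.Exact i p)
    (hi : Function.Injective i) (hp : Function.Surjective p) : (gpSC i p h).ShortExact where
  exact := (ShortComplex.ShortExact.moduleCat_exact_iff_function_exact _).mpr h
  mono_f := (ModuleCat.mono_iff_injective _).2 hi
  epi_g := (ModuleCat.epi_iff_surjective _).2 hp

variable (i : K →ₗ[S] P) (p : P →ₗ[S] G) (h : Function.Exact i p)
    (hi : Function.Injective i) (hp : Function.Surjective p) (Y : ModuleCat.{0} S)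

include h hi hp

lemma gp_ext_ker (n : ℕ) (hG : Subsingleton (Abelian.Ext (ModuleCat.of S G) Y (n+1)))
    (hP : Subsingleton (Abelian.Ext (ModuleCat.of S P) Y n)) :
    Subsingleton (Abelian.Ext (ModuleCat.of S K) Y n) := by
  refine subsingleton_of_forall_eq 0 fun x => ?_
  have hS := gpSC_shortExact i p h hi hp
  obtain ⟨y, hy⟩ := Abelian.Ext.contravariant_sequence_exact₁ hS Y x (n₁ := n+1) (by omega)
    (@Subsingleton.elim _ hG _ _)
  have hy0 : y = 0 := @Subsingleton.elim _ hP _ _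
  rw [← hy, hy0, Abelian.Ext.comp_zero]
  rfl

lemma gp_ext_lift (hG : Subsingleton (Abelian.Ext (ModuleCat.of S G) (ModuleCat.of S S) 1))
    (k : K →ₗ[S] S) : ∃ l : P →ₗ[S] S, l ∘ₗ i = k := by
  have hS := gpSC_shortExact i p h hi hp
  obtain ⟨y, hy⟩ := Abelian.Ext.contravariant_sequence_exact₁ hS (ModuleCat.of S S)
    (Abelian.Ext.mk₀ (ModuleCat.ofHom k)) (n₁ := 1) (by omega)
    (@Subsingleton.elim _ hG _ _)
  obtain ⟨l, rfl⟩ := Abelian.Ext.homEquiv₀.symm.surjective y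
  refine ⟨ModuleCat.Hom.hom l, ?_⟩
  erw [Abelian.Ext.homEquiv₀_symm_apply, Abelian.Ext.mk₀_comp_mk₀] at hy
  have := Abelian.Ext.homEquiv₀.symm.injective hy
  exact congrArg ModuleCat.Hom.hom this

lemma gp_ext_coker (n : ℕ) (hK : Subsingleton (Abelian.Ext (ModuleCat.of S K) Y n))
    (hP : Subsingleton (Abelian.Ext (ModuleCat.of S P) Y (n+1))) :
    Subsingleton (Abelian.Ext (ModuleCat.of S G) Y (n+1)) := by
  refine subsingleton_of_forall_eq 0 fun x => ?_
  have hS := gpSC_shortExact i p h hi hp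
  obtain ⟨y, hy⟩ := Abelian.Ext.contravariant_sequence_exact₃ hS _ x
    (@Subsingleton.elim _ hP _ _) (n₀ := n) (by omega)
  have hy0 : y = 0 := @Subsingleton.elim _ hK _ _
  rw [← hy, hy0, Abelian.Ext.comp_zero]
  rfl

lemma gp_ext_coker_one (hK : ∀ k : K →ₗ[S] S, ∃ l : P →ₗ[S] S, l ∘ₗ i = k)
    (hP : Subsingleton (Abelian.Ext (ModuleCat.of S P) (ModuleCat.of S S) 1)) :
    Subsingleton (Abelian.Ext (ModuleCat.of S G) (ModuleCat.of S S) 1) := by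
  refine subsingleton_of_forall_eq 0 fun x => ?_
  have hS := gpSC_shortExact i p h hi hp
  obtain ⟨y, hy⟩ := Abelian.Ext.contravariant_sequence_exact₃ hS _ x
    (@Subsingleton.elim _ hP _ _) (n₀ := 0) (by omega)
  obtain ⟨k, rfl⟩ := Abelian.Ext.homEquiv₀.symm.surjective y
  obtain ⟨l, hl⟩ := hK (ModuleCat.Hom.hom k)
  obtain ⟨l', hk⟩ : ∃ l' : (gpSC i p h).X₂ ⟶ ModuleCat.of S S, k = (gpSC i p h).f ≫ l' := by
    refine ⟨ModuleCat.ofHom l, ?_⟩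
    apply ModuleCat.hom_ext
    exact hl.symm
  rw [← hy, Abelian.Ext.homEquiv₀_symm_apply, hk, ← Abelian.Ext.mk₀_comp_mk₀,
    hS.extClass_comp_assoc]
  rfl

end

lemma gp_ext_proj (S : Type) [CommRing S] (P : Type) [AddCommGroup P] [Module S P]
    [Module.Projective S P] (Y : ModuleCat.{0} S) (n : ℕ) :
    Subsingleton (Abelian.Ext (ModuleCat.of S P) Y (n+1)) := by
  have : Projective (ModuleCat.of S P) := (IsProjective.iff_projective P).1 inferInstance
  exact Abelian.Ext.subsingleton_of_projective _ _ _

lemma isGP_iff (S : Type) [CommRing S] (M : Type) [AddCommGroup M] [Module S M] :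
    IsGP S M ↔ Function.Bijective (Module.Dual.eval S M) ∧
      (∀ n, Subsingleton (Abelian.Ext (ModuleCat.of S M) (ModuleCat.of S S) (n+1))) ∧
      (∀ n, Subsingleton (Abelian.Ext (ModuleCat.of S (Module.Dual S M))
        (ModuleCat.of S S) (n+1))) := by
  unfold IsGP
  refine and_congr Iff.rfl (and_congr ?_ ?_) <;>
  · constructor
    · intro H n
      exact (gp_ext_bridge _ _ _ _).1 (H (n+1) n.succ_pos)
    · rintro H (_ | n) hn
      · omega
      · exact (gp_ext_bridge _ _ _ _).2 (H n)

lemma isGP_proj (S : Type) [CommRing S] (P : Type) [AddCommGroup P] [Module S P]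
    [Module.Finite S P] [Module.Projective S P] : IsGP S P :=
  (isGP_iff S P).2 ⟨Module.bijective_dual_eval S P, fun n => gp_ext_proj S P _ n,
    fun n => gp_ext_proj S (Module.Dual S P) _ n⟩

lemma isGP_ker (S : Type) [CommRing S] {P G : Type} [AddCommGroup P] [Module S P]
    [AddCommGroup G] [Module S G] [Module.Finite S P] [Module.Projective S P]
    (p : P →ₗ[S] G) (hp : Function.Surjective p) (hG : IsGP S G) :
    IsGP S (LinearMap.ker p) := by
  obtain ⟨hGb, hG1, hG2⟩ := (isGP_iff S G).1 hG
  obtain ⟨hPb, hP1, hP2⟩ := (isGP_iff S P).1 (isGP_proj S P)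
  let i := (LinearMap.ker p).subtype
  have hi : Function.Injective i := Subtype.val_injective
  have h : Function.Exact i p := LinearMap.exact_subtype_ker_map p
  have hlift := gp_ext_lift i p h hi hp (hG1 0)
  -- the dual sequence
  have hd : Function.Exact p.dualMap i.dualMap := by
    intro l
    constructor
    · intro hl
      have hker : LinearMap.ker p ≤ LinearMap.ker l := fun x hx =>
        LinearMap.congr_fun hl (⟨x, hx⟩ : LinearMap.ker p)
      obtain ⟨s, hs⟩ := hp.hasRightInverse
      have key : ∀ x y, p x = p y → l x = l y := fun x y hxy => by
        have : x - y ∈ LinearMap.ker l := hker (by simp [hxy])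
        simpa [sub_eq_zero] using this
      refine ⟨{ toFun := fun g => l (s g), map_add' := ?_, map_smul' := ?_ }, ?_⟩
      · intro a b
        rw [← map_add]; apply key; simp [hs _]
      · intro a b
        rw [RingHom.id_apply, ← map_smul]; apply key; simp [hs _]
      · ext x
        exact key _ _ (hs _)
    · rintro ⟨g, rfl⟩
      ext x
      show g (p (i x)) = 0
      rw [h.apply_apply_eq_zero, map_zero]
  have hdi : Function.Injective p.dualMap := LinearMap.dualMap_injective_of_surjective hp
  have hdp : Function.Surjective i.dualMap := hlift
  refine (isGP_iff S _).2 ⟨⟨?_, ?_⟩, ?_, ?_⟩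
  · rw [injective_iff_map_eq_zero]
    intro k hk
    apply hi
    rw [map_zero]
    apply hPb.1
    rw [map_zero]
    ext l
    exact LinearMap.congr_fun hk (l ∘ₗ i)
  · intro ξ
    obtain ⟨x, hx⟩ := hPb.2 (ξ ∘ₗ i.dualMap)
    have hx' : ∀ l : Module.Dual S P, l x = ξ (l ∘ₗ i) := fun l => LinearMap.congr_fun hx l
    have hpx : p x = 0 := by
      apply hGb.1
      rw [map_zero]
      ext l
      show l (p x) = 0
      have := hx' (l ∘ₗ p)
      rw [LinearMap.comp_apply] at this
      rw [this, LinearMap.comp_assoc, h.linearMap_comp_eq_zero, LinearMap.comp_zero, map_zero]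
    refine ⟨⟨x, hpx⟩, ?_⟩
    ext m
    obtain ⟨l, rfl⟩ := hlift m
    exact hx' l
  · intro n
    exact gp_ext_ker i p h hi hp _ (n+1) (hG1 (n+1)) (hP1 n)
  · rintro (_ | n)
    · refine gp_ext_coker_one p.dualMap i.dualMap hd hdi hdp ?_ (hP2 0)
      intro k
      obtain ⟨g, rfl⟩ := hGb.2 k
      obtain ⟨x, rfl⟩ := hp g
      exact ⟨Module.Dual.eval S P x, rfl⟩
    · exact gp_ext_coker p.dualMap i.dualMap hd hdi hdp _ (n+1) (hG2 n) (hP2 (n+1))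

/-- `Mon(ω, 𝒢)` has enough projectives: every object `(g1 : G1 → G0)`
admits an admissible epic from a projective object
`(id ⊕ ω : P1 ⊕ P0 → P1 ⊕ P0)` with `P1, P0` finitely generated projective. -/
theorem stmt_7 (S : Type) [CommRing S] [IsNoetherianRing S] [IsLocalRing S]
    (ω : S) (hω : ω ∈ IsLocalRing.maximalIdeal S) (hreg : ω ∈ nonZeroDivisors S)
    (G1 G0 : Type) [AddCommGroup G1] [Module S G1] [AddCommGroup G0] [Module S G0]
    (g1 : G1 →ₗ[S] G0) (hg1 : MonObj S ω g1) :
    ∃ (P1 P0 : ModuleCat S),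
      Module.Finite S P1 ∧ Module.Projective S P1 ∧
      Module.Finite S P0 ∧ Module.Projective S P0 ∧
      MonObj S ω ((LinearMap.id : P1 →ₗ[S] P1).prodMap
          (ω • (LinearMap.id : P0 →ₗ[S] P0))) ∧
      ∃ (φ1 : P1 × P0 →ₗ[S] G1) (φ0 : P1 × P0 →ₗ[S] G0),
        ∃ hcomm : g1 ∘ₗ φ1 =
            φ0 ∘ₗ ((LinearMap.id : P1 →ₗ[S] P1).prodMap
              (ω • (LinearMap.id : P0 →ₗ[S] P0))),
          Function.Surjective φ1 ∧ Function.Surjective φ0 ∧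
          MonObj S ω
            (((LinearMap.id : P1 →ₗ[S] P1).prodMap
                (ω • (LinearMap.id : P0 →ₗ[S] P0))).restrict
              (p := LinearMap.ker φ1) (q := LinearMap.ker φ0) (fun x hx => by
                have e := LinearMap.congr_fun hcomm x
                simp only [LinearMap.comp_apply] at e
                simp only [LinearMap.mem_ker] at hx ⊢
                rw [← e, hx, map_zero])) := by
  obtain ⟨hf1, hf0, hGP1, hGP0, hinj, hω'⟩ := hg1
  obtain ⟨n1, π1, hπ1⟩ := Module.Finite.exists_fin' S G1
  obtain ⟨n0, π0, hπ0⟩ := Module.Finite.exists_fin' S G0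
  choose g2f hg2 using hω'
  let g2 : G0 →ₗ[S] G1 :=
    { toFun := g2f
      map_add' := fun a b => hinj (by simp [hg2])
      map_smul' := fun a b => hinj (by rw [RingHom.id_apply, map_smul, hg2, hg2, smul_comm]) }
  have hg2' : ∀ y, g1 (g2 y) = ω • y := hg2
  have hregS : ∀ a b : S, ω * a = ω * b → a = b := fun a b hab =>
    (mul_cancel_left_mem_nonZeroDivisors hreg).1 hab
  have hinjP : Function.Injective ((LinearMap.id : (Fin n1 → S) →ₗ[S] (Fin n1 → S)).prodMap
      (ω • (LinearMap.id : (Fin n0 → S) →ₗ[S] (Fin n0 → S)))) := by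
    rintro ⟨a, b⟩ ⟨c, d⟩ hab
    have h1 : a = c := congrArg Prod.fst hab
    have h2 : ω • b = ω • d := congrArg Prod.snd hab
    refine Prod.ext h1 (funext fun j => hregS _ _ (congrFun h2 j))
  refine ⟨ModuleCat.of S (Fin n1 → S), ModuleCat.of S (Fin n0 → S),
    inferInstanceAs (Module.Finite S (Fin n1 → S)),
    inferInstanceAs (Module.Projective S (Fin n1 → S)),
    inferInstanceAs (Module.Finite S (Fin n0 → S)),
    inferInstanceAs (Module.Projective S (Fin n0 → S)), ?_, ?_⟩
  · refine ⟨inferInstanceAs (Module.Finite S ((Fin n1 → S) × (Fin n0 → S))),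
      inferInstanceAs (Module.Finite S ((Fin n1 → S) × (Fin n0 → S))),
      isGP_proj S ((Fin n1 → S) × (Fin n0 → S)), isGP_proj S ((Fin n1 → S) × (Fin n0 → S)),
      hinjP, ?_⟩
    rintro ⟨a, b⟩
    exact ⟨(ω • a, b), rfl⟩
  · let φ1 : (Fin n1 → S) × (Fin n0 → S) →ₗ[S] G1 := π1.coprod (g2 ∘ₗ π0)
    let φ0 : (Fin n1 → S) × (Fin n0 → S) →ₗ[S] G0 := (g1 ∘ₗ π1).coprod π0
    have hs1 : Function.Surjective φ1 := fun g => by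
      obtain ⟨x, rfl⟩ := hπ1 g
      exact ⟨(x, 0), by simp [φ1]⟩
    have hs0 : Function.Surjective φ0 := fun g => by
      obtain ⟨x, rfl⟩ := hπ0 g
      exact ⟨(0, x), by simp [φ0]⟩
    have hcomm : ∀ (a : Fin n1 → S) (b : Fin n0 → S), g1 (φ1 (a, b)) = φ0 (a, ω • b) := by
      intro a b
      simp [φ1, φ0, hg2']
    refine ⟨φ1, φ0, LinearMap.ext fun x => hcomm x.1 x.2, hs1, hs0, ?_⟩
    refine ⟨inferInstanceAs (Module.Finite S (LinearMap.ker φ1)),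
      inferInstanceAs (Module.Finite S (LinearMap.ker φ0)),
      isGP_ker S φ1 hs1 hGP1, isGP_ker S φ0 hs0 hGP0, ?_, ?_⟩
    · rintro ⟨a, ha⟩ ⟨b, hb⟩ hab
      exact Subtype.ext (hinjP (congrArg Subtype.val hab))
    · rintro ⟨⟨a, b⟩, hab⟩
      refine ⟨⟨(ω • a, b), ?_⟩, rfl⟩
      apply hinj
      refine (hcomm (ω • a) b).trans ?_
      have : φ0 (ω • a, ω • b) = ω • φ0 (a, b) := by
        rw [← map_smul]; rfl
      rw [this, map_zero]
      have h0 : φ0 (a, b) = 0 := hab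
      rw [h0, smul_zero]
end
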